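/- For every odd prime p, the cyclic group ℤ_{2p} of order 2p is a BCI-group. -/

import Mathlib

open SimpleGraph

/-- The bi-Cayley graph `BCay(G,S)`: vertex set `G × {1,2}` (encoded as `G × Fin 2`,
where index `0` stands for part `1` and index `1` for part `2`), with edges
`{(g,1),(sg,2)}` for `g ∈ G`, `s ∈ S`. -/
def BCay (G : Type*) [Group G] (S : Set G) : SimpleGraph (G × Fin 2) :=
  SimpleGraph.fromRel (fun u v => u.2 = 0 ∧ v.2 = 1 ∧ v.1 * u.1⁻¹ ∈ S)

/-- `BCay(G,S)` is a BCI-graph. -/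
def IsBCIGraph (G : Type*) [Group G] (S : Set G) : Prop :=
  ∀ T : Set G, Nonempty (BCay G S ≃g BCay G T) →
    ∃ (g : G) (α : G ≃* G), T = (fun s => g * α s) '' S

/-- `G` is a BCI-group. -/
def IsBCIGroup (G : Type*) [Group G] : Prop :=
  ∀ S : Set G, IsBCIGraph G S

/-- `G` is an `m`-BCI-group. -/
def IsmBCIGroup (G : Type*) [Group G] (m : ℕ) : Prop :=
  ∀ S : Set G, S.ncard ≤ m → IsBCIGraph G S

/-- The Cayley graph `Cay(G,S)`, for `1 ∉ S = S⁻¹`. -/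
def Cay (G : Type*) [Group G] (S : Set G) : SimpleGraph G :=
  SimpleGraph.fromRel (fun x y => y * x⁻¹ ∈ S)

/-- `Cay(G,S)` is a CI-graph. -/
def IsCIGraph (G : Type*) [Group G] (S : Set G) : Prop :=
  ∀ T : Set G, 1 ∉ T → T⁻¹ = T → Nonempty (Cay G S ≃g Cay G T) →
    ∃ α : G ≃* G, T = α '' S

/-- `G` is a CI-group. -/
def IsCIGroup (G : Type*) [Group G] : Prop :=
  ∀ S : Set G, 1 ∉ S → S⁻¹ = S → IsCIGraph G S

/-- `G` is an `m`-CI-group. -/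
def IsmCIGroup (G : Type*) [Group G] (m : ℕ) : Prop :=
  ∀ S : Set G, 1 ∉ S → S⁻¹ = S → S.ncard ≤ m → IsCIGraph G S

theorem BCay_adj_zero_one {G : Type*} [Group G] {S : Set G} (x y : G) :
    (BCay G S).Adj (x, 0) (y, 1) ↔ y * x⁻¹ ∈ S := by
  simp [BCay]

theorem BCay_snd_ne_of_adj {G : Type*} [Group G] {S : Set G} {u v : G × Fin 2}
    (h : (BCay G S).Adj u v) : u.2 ≠ v.2 := by
  simp only [BCay, fromRel_adj] at h
  rcases h with ⟨-, ⟨h₀, h₁, -⟩ | ⟨h₀, h₁, -⟩⟩ <;> simp [h₀, h₁]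

/-- The automorphism `(x, i) ↦ (c * x⁻¹, 1 - i)` of a bi-Cayley graph over an abelian group. -/
def BCayReflect {G : Type*} [CommGroup G] (S : Set G) (c : G) : BCay G S ≃g BCay G S where
  toEquiv := Equiv.prodCongr (Equiv.divLeft c) (Equiv.swap 0 1)
  map_rel_iff' := by
    rintro ⟨x, i⟩ ⟨y, j⟩
    have h (a b : G) : c * a⁻¹ * (b * c⁻¹) = b * a⁻¹ := by
      rw [mul_comm c, mul_assoc, mul_left_comm c, mul_inv_cancel, mul_one, mul_comm]
    fin_cases i <;> fin_cases j <;> simp [BCay, div_eq_mul_inv, h]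

theorem BCayReflect_snd_ne {G : Type*} [CommGroup G] (S : Set G) (c : G) (u : G × Fin 2) :
    (BCayReflect S c u).2 ≠ u.2 := by
  obtain ⟨x, i⟩ := u
  fin_cases i <;> simp [BCayReflect]

/-- Every connected component of a nonempty bi-Cayley graph over an abelian group is
preserved by some reflection. -/
theorem exists_BCayReflect_connectedComponentMk_eq {G : Type*} [CommGroup G] {S : Set G}
    (hS : S.Nonempty) (C : (BCay G S).ConnectedComponent) :
    ∃ c : G, ∀ u, (BCay G S).connectedComponentMk u = C →
      (BCay G S).connectedComponentMk (BCayReflect S c u) = C := by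
  obtain ⟨s, hs⟩ := hS
  have key (c : G) (u : G × Fin 2) (h : (BCay G S).Adj u (BCayReflect S c u)) :
      ∀ v, (BCay G S).connectedComponentMk v = (BCay G S).connectedComponentMk u →
        (BCay G S).connectedComponentMk (BCayReflect S c v) =
          (BCay G S).connectedComponentMk u := by
    intro v hv
    rw [ConnectedComponent.eq] at hv ⊢
    exact (hv.map (BCayReflect S c).toHom).trans h.reachable.symm
  induction C using ConnectedComponent.ind with
  | h u =>
    obtain ⟨x, i⟩ := u
    fin_cases i
    · refine ⟨x * x * s, key _ _ ?_⟩
      simpa [BCayReflect, BCay_adj_zero_one, mul_assoc, mul_div_assoc] using hs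
    · refine ⟨x * x * s⁻¹, key _ _ ?_⟩
      rw [adj_comm]
      simpa [BCayReflect, BCay_adj_zero_one, mul_assoc, mul_div_assoc] using hs

/-- A graph isomorphism between bi-Cayley graphs over a finite abelian group can be replaced by
one which preserves the two parts. -/
theorem exists_perm_of_BCay_iso {G : Type*} [CommGroup G] [Finite G] {S T : Set G}
    (φ : BCay G S ≃g BCay G T) :
    ∃ f h : Equiv.Perm G, ∀ x y, h y * (f x)⁻¹ ∈ T ↔ y * x⁻¹ ∈ S := by
  classical
  suffices H : ∃ ψ : G × Fin 2 → G × Fin 2, Function.Injective ψ ∧ (∀ u, (ψ u).2 = u.2) ∧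
      ∀ u v, (BCay G T).Adj (ψ u) (ψ v) ↔ (BCay G S).Adj u v by
    obtain ⟨ψ, hinj, hsnd, hadj⟩ := H
    have hψ (x : G) (i : Fin 2) : ((ψ (x, i)).1, i) = ψ (x, i) := Prod.ext rfl (hsnd (x, i)).symm
    have hbij (i : Fin 2) : Function.Bijective fun x ↦ (ψ (x, i)).1 := by
      refine Finite.injective_iff_bijective.mp fun x y hxy ↦ ?_
      have : ψ (x, i) = ψ (y, i) := by rw [← hψ x, ← hψ y]; exact congrArg (·, i) hxy
      exact congrArg Prod.fst (hinj this)
    refine ⟨Equiv.ofBijective _ (hbij 0), Equiv.ofBijective _ (hbij 1), fun x y ↦ ?_⟩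
    rw [← BCay_adj_zero_one, ← BCay_adj_zero_one, ← hadj, ← hψ x, ← hψ y]
    rfl
  rcases S.eq_empty_or_nonempty with rfl | hS
  · refine ⟨id, Function.injective_id, fun _ ↦ rfl, fun u v ↦ ?_⟩
    have h₁ (u v) : ¬ (BCay G (∅ : Set G)).Adj u v := by simp [BCay]
    have h₂ (u v) : ¬ (BCay G T).Adj u v := by
      rw [← φ.symm.map_adj_iff]; exact h₁ _ _
    exact iff_of_false (h₂ _ _) (h₁ _ _)
  choose c hc using exists_BCayReflect_connectedComponentMk_eq hS
  let k := (BCay G S).connectedComponentMk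
  have swap_iff {u v : G × Fin 2} (h : k u = k v) : (φ u).2 = u.2 ↔ (φ v).2 = v.2 := by
    obtain ⟨w⟩ := ConnectedComponent.exact h
    induction w with
    | nil => rfl
    | cons hadj w ih =>
      refine Iff.trans ?_ (ih (ConnectedComponent.sound w.reachable))
      have h₁ := BCay_snd_ne_of_adj hadj
      have h₂ := BCay_snd_ne_of_adj (φ.map_adj_iff.mpr hadj)
      omega
  let σ (u : G × Fin 2) : G × Fin 2 := if (φ u).2 = u.2 then u else BCayReflect S (c (k u)) u
  have hkσ (u) : k (σ u) = k u := by
    by_cases hu : (φ u).2 = u.2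
    · simp [σ, hu]
    · simpa [σ, hu] using hc (k u) u rfl
  refine ⟨fun u ↦ φ (σ u), ?_, fun u ↦ ?_, fun u v ↦ ?_⟩
  · intro u v huv
    have hσ : σ u = σ v := φ.injective huv
    have hk : k u = k v := by rw [← hkσ u, hσ, hkσ]
    by_cases hu : (φ u).2 = u.2
    · simpa [σ, hu, (swap_iff hk).mp hu] using hσ
    · simpa [σ, hu, mt (swap_iff hk).mpr hu, hk] using hσ
  · by_cases hu : (φ u).2 = u.2
    · simp [σ, hu]
    · have h₁ := mt (swap_iff (hkσ u)).mp hu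
      have h₂ : (σ u).2 ≠ u.2 := by simpa [σ, hu] using BCayReflect_snd_ne S (c (k u)) u
      dsimp only
      omega
  · rw [φ.map_adj_iff]
    have aux (hk : k u = k v) : (BCay G S).Adj (σ u) (σ v) ↔ (BCay G S).Adj u v := by
      by_cases hu : (φ u).2 = u.2
      · simp [σ, hu, (swap_iff hk).mp hu]
      · simp only [σ, hu, mt (swap_iff hk).mpr hu, hk, if_false]
        exact (BCayReflect S _).map_adj_iff
    constructor
    · intro h
      refine (aux ?_).mp h
      rw [← hkσ u, ← hkσ v]
      exact ConnectedComponent.sound h.reachable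
    · exact fun h ↦ (aux (ConnectedComponent.sound h.reachable)).mpr h

/-- For an odd prime `p`, a `p`-group of permutations of `2p` points is abelian. -/
theorem IsPGroup.mul_comm_of_card_eq_two_mul {p : ℕ} [Fact p.Prime] (hodd : Odd p) {α : Type*}
    [Finite α] (hα : Nat.card α = 2 * p) {P : Subgroup (Equiv.Perm α)} (hP : IsPGroup p P)
    {x y : Equiv.Perm α} (hx : x ∈ P) (hy : y ∈ P) : x * y = y * x := by
  have hp : p.Prime := Fact.out
  have hp2 : 2 < p := lt_of_le_of_ne hp.two_le fun h ↦ absurd hodd (by rw [← h]; decide)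
  obtain ⟨n, hn⟩ := IsPGroup.iff_card.mp hP
  have hn2 : n ≤ 2 := by
    have hdvd : p ^ n ∣ (p * 2).factorial := by
      rw [← hn, mul_comm, ← hα, ← Nat.card_perm]
      exact P.card_subgroup_dvd_card
    rw [padicValNat_dvd_iff_le (Nat.factorial_ne_zero _), padicValNat_factorial_mul,
      padicValNat.eq_zero_of_not_dvd (mt hp.dvd_factorial.mp (by omega))] at hdvd
    omega
  have hcomm : IsMulCommutative P := by
    interval_cases n
    · have : Subsingleton P := (Nat.card_eq_one_iff_unique.mp (by simpa using hn)).1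
      exact ⟨⟨fun a b ↦ Subsingleton.elim _ _⟩⟩
    · have := isCyclic_of_prime_card (p := p) (by simpa using hn)
      exact IsCyclic.isMulCommutative
    · exact IsPGroup.isMulCommutative_of_card_eq_prime_sq hn
  exact congrArg Subtype.val (hcomm.is_comm.comm ⟨x, hx⟩ ⟨y, hy⟩)

theorem ZMod.eq_add_zero_of_surjective {s : ZMod 2 → ZMod 2} (hs : Function.Surjective s)
    (i : ZMod 2) : s i = i + s 0 := by
  revert s i
  decide

/-- A permutation of `ℤ₂ × ℤₚ` is affine on every `ℤₚ`-coset as soon as the translation by `(0, 1)`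
commutes with its conjugate under this permutation. -/
theorem exists_affine_of_commute {p : ℕ} [Fact p.Prime] (hodd : Odd p)
    {r f : Equiv.Perm (ZMod 2 × ZMod p)} (hr : ∀ v, r v = v + (0, 1))
    (hcomm : r * (f⁻¹ * r * f) = f⁻¹ * r * f * r) :
    ∃ (π : ZMod 2) (b c : ZMod 2 → ZMod p), (∀ i, b i ≠ 0) ∧
      ∀ i x, f (i, x) = (i + π, b i * x + c i) := by
  set q := f⁻¹ * r * f with hq
  have hfq (v) : f (q v) = f v + (0, 1) := by simp [hq, hr]
  have hqr (v) : q (v + (0, 1)) = q v + (0, 1) := by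
    rw [← hr, ← hr]; exact (DFunLike.congr_fun hcomm v).symm
  have q_apply (i : ZMod 2) (x : ZMod p) : q (i, x) = q (i, 0) + (0, x) := by
    obtain ⟨n, rfl⟩ := ZMod.natCast_zmod_surjective x
    induction n with
    | zero => simp
    | succ n ih =>
      have := hqr (i, (n : ZMod p))
      rw [ih, add_assoc] at this
      simpa using this
  have q_fst (v) : (q v).1 = v.1 + (q (0, 0)).1 := by
    have hs : Function.Surjective fun i ↦ (q (i, 0)).1 := by
      intro j
      obtain ⟨⟨i, x⟩, hv⟩ := q.surjective (j, 0)
      refine ⟨i, ?_⟩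
      simpa [q_apply i x] using congrArg Prod.fst hv
    have := ZMod.eq_add_zero_of_surjective hs v.1
    rw [show v = (v.1, v.2) from rfl, q_apply]
    simpa using this
  have iter_fst (n : ℕ) (v) : ((q ^ n) v).1 = v.1 + n * (q (0, 0)).1 := by
    induction n with
    | zero => simp
    | succ n ih => rw [pow_succ', Equiv.Perm.mul_apply, q_fst, ih]; push_cast; ring
  have iter_f (n : ℕ) (v) : f ((q ^ n) v) = f v + (0, (n : ZMod p)) := by
    induction n with
    | zero => simp
    | succ n ih => rw [pow_succ', Equiv.Perm.mul_apply, hfq, ih, add_assoc]; simp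
  have hq0 : (q (0, 0)).1 = 0 := by
    have h₁ : (q ^ p) (0, 0) = (0, 0) := f.injective (by rw [iter_f]; simp)
    have h₂ := iter_fst p (0, 0)
    rw [h₁, (ZMod.natCast_eq_one_iff_odd).mpr hodd] at h₂
    simpa using h₂.symm
  let a (i : ZMod 2) : ZMod p := (q (i, 0)).2
  have hqa (i x) : q (i, x) = (i, x + a i) := by
    rw [q_apply]
    ext
    · simp [q_fst (i, 0), hq0]
    · simp [a, add_comm]
  have ha (i) : a i ≠ 0 := by
    intro h
    have := hfq (i, 0)
    rw [hqa, h] at this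
    simp [Prod.ext_iff] at this
  have iter_q (n : ℕ) (i) : (q ^ n) (i, 0) = (i, n * a i) := by
    induction n with
    | zero => simp
    | succ n ih => rw [pow_succ', Equiv.Perm.mul_apply, ih, hqa]; push_cast; ring_nf
  have hf (i x) : f (i, x) = ((f (i, 0)).1, (a i)⁻¹ * x + (f (i, 0)).2) := by
    obtain ⟨n, hn⟩ := ZMod.natCast_zmod_surjective ((a i)⁻¹ * x)
    have h := iter_f n (i, 0)
    rw [iter_q, hn, mul_comm, mul_inv_cancel_left₀ (ha i)] at h
    rw [h]
    ext <;> simp [add_comm]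
  have hs : Function.Surjective fun i ↦ (f (i, 0)).1 := by
    intro j
    obtain ⟨⟨i, x⟩, hv⟩ := f.surjective (j, 0)
    rw [hf] at hv
    exact ⟨i, congrArg Prod.fst hv⟩
  refine ⟨(f (0, 0)).1, fun i ↦ (a i)⁻¹, fun i ↦ (f (i, 0)).2, fun i ↦ inv_ne_zero (ha i),
    fun i x ↦ ?_⟩
  rw [hf]
  exact Prod.ext (ZMod.eq_add_zero_of_surjective hs i) rfl

/-- The group of pairs of permutations of `K` preserving the relation `y - x ∈ S`. -/
def differencePerms {K : Type*} [AddCommGroup K] (S : Set K) :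
    Subgroup (Equiv.Perm K × Equiv.Perm K) where
  carrier := {a | ∀ x y, a.2 y - a.1 x ∈ S ↔ y - x ∈ S}
  mul_mem' {a b} ha hb x y := (ha (b.1 x) (b.2 y)).trans (hb x y)
  one_mem' _ _ := Iff.rfl
  inv_mem' {a} ha x y := by
    rw [← ha]
    simp

/-- Up to automorphisms of the source, an isomorphism between difference relations on a group of
order `2p` conjugates a given translation of order `p` to permutations commuting with it. -/
theorem exists_commute_conj {p : ℕ} [Fact p.Prime] (hodd : Odd p) {K : Type*} [AddCommGroup K]
    [Finite K] (hK : Nat.card K = 2 * p) {r : Equiv.Perm K} {t : K} (hr : ∀ v, r v = v + t)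
    (hrp : r ^ p = 1) {S T : Set K} {f h : Equiv.Perm K}
    (hfh : ∀ x y, h y - f x ∈ T ↔ y - x ∈ S) :
    ∃ f' h' : Equiv.Perm K, (∀ x y, h' y - f' x ∈ T ↔ y - x ∈ S) ∧
      r * (f'⁻¹ * r * f') = f'⁻¹ * r * f' * r ∧ r * (h'⁻¹ * r * h') = h'⁻¹ * r * h' * r := by
  let ρ : differencePerms S := ⟨(r, r), fun x y ↦ by simp [hr]⟩
  let ρ' : differencePerms S := ⟨(f⁻¹ * r * f, h⁻¹ * r * h), fun x y ↦ by
    rw [← hfh]; simp [hr, hfh]⟩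
  have hρ : ρ ^ p = 1 := Subtype.ext (Prod.ext hrp hrp)
  have hρ' : ρ' ^ p = 1 := by
    have hconj (g : Equiv.Perm K) : (g⁻¹ * r * g) ^ p = 1 := by
      have := conj_pow (a := g⁻¹) (b := r) (i := p)
      rw [inv_inv] at this
      rw [this, hrp]; simp
    exact Subtype.ext (Prod.ext (hconj f) (hconj h))
  have isPGroup_zpowers {x : differencePerms S} (hx : x ^ p = 1) :
      IsPGroup p (Subgroup.zpowers x) := by
    refine IsPGroup.of_card_dvd_pow (n := 1) ?_
    rw [Nat.card_zpowers, pow_one]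
    exact orderOf_dvd_of_pow_eq_one hx
  obtain ⟨P, hP⟩ := (isPGroup_zpowers hρ).exists_le_sylow
  obtain ⟨Q, hQ⟩ := (isPGroup_zpowers hρ').exists_le_sylow
  obtain ⟨a, rfl⟩ := MulAction.exists_smul_eq (differencePerms S) Q P
  have hρP : ρ ∈ a • Q := hP (Subgroup.mem_zpowers ρ)
  have hρ'P : a * ρ' * a⁻¹ ∈ a • Q :=
    Subgroup.smul_mem_pointwise_smul ρ' (MulAut.conj a) Q.1 (hQ (Subgroup.mem_zpowers ρ'))
  refine ⟨f * a.1.1⁻¹, h * a.1.2⁻¹, fun x y ↦ ?_, ?_, ?_⟩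
  · have := (a⁻¹).2 x y
    rw [← this]
    exact hfh _ _
  · have := ((a • Q).isPGroup'.map
      ((MonoidHom.fst _ _).comp (differencePerms S).subtype)).mul_comm_of_card_eq_two_mul hodd hK
      (Subgroup.mem_map_of_mem _ hρP) (Subgroup.mem_map_of_mem _ hρ'P)
    simpa [ρ, ρ', mul_assoc] using this
  · have := ((a • Q).isPGroup'.map
      ((MonoidHom.snd _ _).comp (differencePerms S).subtype)).mul_comm_of_card_eq_two_mul hodd hK
      (Subgroup.mem_map_of_mem _ hρP) (Subgroup.mem_map_of_mem _ hρ'P)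
    simpa [ρ, ρ', mul_assoc] using this

/-- Two sets whose difference relations correspond under affine maps with distinct slopes are
both empty or both full. -/
theorem eq_empty_or_univ_of_slope_ne {F : Type*} [Field F] {A B : Set F} {b b' c : F}
    (hb : b' ≠ b) (h : ∀ x y, b' * y - b * x + c ∈ B ↔ y - x ∈ A) :
    (A = ∅ ∧ B = ∅) ∨ (A = Set.univ ∧ B = Set.univ) := by
  have hd : b' - b ≠ 0 := sub_ne_zero.mpr hb
  have key (u v : F) : v ∈ B ↔ u ∈ A := by
    have := h ((v - c - b' * u) / (b' - b)) ((v - c - b' * u) / (b' - b) + u)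
    rw [add_sub_cancel_left] at this
    rw [← this]
    congr! 1
    field_simp
    ring
  by_cases hA : (0 : F) ∈ A
  · have hB (v) : v ∈ B := (key 0 v).mpr hA
    exact .inr ⟨Set.eq_univ_of_forall fun u ↦ (key u 0).mp (hB 0), Set.eq_univ_of_forall hB⟩
  · have hB (v) : v ∉ B := mt (key 0 v).mp hA
    exact .inl ⟨Set.eq_empty_of_forall_notMem fun u hu ↦ hB 0 ((key u 0).mpr hu),
      Set.eq_empty_of_forall_notMem hB⟩

/-- A subset of `ℤₚ` with a nonzero period is empty or full. -/
theorem ZMod.eq_empty_or_univ_of_add_mem_iff {p : ℕ} [Fact p.Prime] {A : Set (ZMod p)}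
    {d : ZMod p} (hd : d ≠ 0) (h : ∀ x, x + d ∈ A ↔ x ∈ A) : A = ∅ ∨ A = Set.univ := by
  have key (x : ZMod p) : x ∈ A ↔ 0 ∈ A := by
    obtain ⟨n, hn⟩ := ZMod.natCast_zmod_surjective (x * d⁻¹)
    have hx : x = n * d := by rw [hn, inv_mul_cancel_right₀ hd]
    rw [hx]
    clear hn hx
    induction n with
    | zero => simp
    | succ n ih => refine Iff.trans ?_ ih; rw [← h (n * d)]; push_cast; rw [add_one_mul]
  by_cases h0 : (0 : ZMod p) ∈ A
  · exact .inr (Set.eq_univ_of_forall fun x ↦ (key x).mpr h0)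
  · exact .inl (Set.eq_empty_of_forall_notMem fun x ↦ mt (key x).mp h0)

/-- A set corresponding to another one under two distinct affine maps of the same slope is
empty or full, and so is the other one. -/
theorem ZMod.eq_empty_or_univ_of_shift_ne {p : ℕ} [Fact p.Prime] {A B : Set (ZMod p)}
    {β γ γ' : ZMod p} (hβ : β ≠ 0) (hγ : γ ≠ γ') (h : ∀ x, β * x + γ ∈ B ↔ x ∈ A)
    (h' : ∀ x, β * x + γ' ∈ B ↔ x ∈ A) :
    (A = ∅ ∧ B = ∅) ∨ (A = Set.univ ∧ B = Set.univ) := by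
  have hB (v) : v ∈ B ↔ β⁻¹ * (v - γ) ∈ A := by
    rw [← h, mul_inv_cancel_left₀ hβ, sub_add_cancel]
  have hA : A = ∅ ∨ A = Set.univ := by
    refine ZMod.eq_empty_or_univ_of_add_mem_iff (d := β⁻¹ * (γ - γ'))
      (mul_ne_zero (inv_ne_zero hβ) (sub_ne_zero.mpr hγ)) fun x ↦ ?_
    rw [← h', mul_add, mul_inv_cancel_left₀ hβ, add_assoc, sub_add_cancel, h]
  rcases hA with rfl | rfl
  · exact .inl ⟨rfl, Set.eq_empty_of_forall_notMem fun v ↦ (hB v).not.mpr (Set.notMem_empty _)⟩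
  · exact .inr ⟨rfl, Set.eq_univ_of_forall fun v ↦ (hB v).mpr trivial⟩

/-- Isomorphic difference relations on `ℤ₂ × ℤₚ` come from affinely equivalent sets. -/
theorem exists_affine_equiv_of_difference_iso {p : ℕ} [Fact p.Prime] (hodd : Odd p)
    {S T : Set (ZMod 2 × ZMod p)} {f h : Equiv.Perm (ZMod 2 × ZMod p)}
    (hfh : ∀ x y, h y - f x ∈ T ↔ y - x ∈ S) :
    ∃ (g : ZMod 2 × ZMod p) (α : ZMod 2 × ZMod p ≃+ ZMod 2 × ZMod p),
      ∀ x, g + α x ∈ T ↔ x ∈ S := by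
  let r : Equiv.Perm (ZMod 2 × ZMod p) := Equiv.addRight (0, 1)
  have hr (v) : r v = v + (0, 1) := rfl
  have hrp : r ^ p = 1 := by
    have (n : ℕ) (v) : (r ^ n) v = v + (0, (n : ZMod p)) := by
      induction n with
      | zero => simp
      | succ n ih => rw [pow_succ', Equiv.Perm.mul_apply, hr, ih, add_assoc]; simp
    ext1 v
    rw [this]
    simp
  obtain ⟨f, h, hfh, hf, hh⟩ := exists_commute_conj hodd (by simp) hr hrp hfh
  obtain ⟨π, b, c, hb, hf⟩ := exists_affine_of_commute hodd hr hf
  obtain ⟨π', b', c', -, hh⟩ := exists_affine_of_commute hodd hr hh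
  let A (k : ZMod 2) : Set (ZMod p) := {x | (k, x) ∈ S}
  let B (k : ZMod 2) : Set (ZMod p) := {x | (k + (π' - π), x) ∈ T}
  have hAB (i j) (x y : ZMod p) :
      b' j * y - b i * x + (c' j - c i) ∈ B (j - i) ↔ y - x ∈ A (j - i) := by
    have := hfh (i, x) (j, y)
    rw [hf, hh, Prod.mk_sub_mk, Prod.mk_sub_mk] at this
    rw [show b' j * y + c' j - (b i * x + c i) = b' j * y - b i * x + (c' j - c i) by ring,
      add_sub_add_comm] at this
    exact this
  let Trivial (k : ZMod 2) : Prop := (A k = ∅ ∧ B k = ∅) ∨ (A k = Set.univ ∧ B k = Set.univ)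
  have slope (i j) : b' j = b i ∨ Trivial (j - i) :=
    or_iff_not_imp_left.mpr fun hne ↦ eq_empty_or_univ_of_slope_ne hne (hAB i j)
  have affine (i j) (hij : b' j = b i) (x) :
      b i * x + (c' j - c i) ∈ B (j - i) ↔ x ∈ A (j - i) := by
    have := hAB i j 0 x
    simpa [hij] using this
  suffices H : ∃ β γ : ZMod p, β ≠ 0 ∧ ∀ k x, β * x + γ ∈ B k ↔ x ∈ A k by
    obtain ⟨β, γ, hβ, H⟩ := H
    refine ⟨(π' - π, γ), AddEquiv.prodCongr (AddEquiv.refl _)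
      { Equiv.mulLeft₀ β hβ with map_add' := mul_add β }, fun ⟨k, x⟩ ↦ ?_⟩
    rw [← show _ ↔ (k, x) ∈ S from H k x]
    change (π' - π + k, γ + β * x) ∈ T ↔ (k + (π' - π), β * x + γ) ∈ T
    rw [add_comm k, add_comm γ]
  have trivial_mem {k} (hk : Trivial k) (u v) : u ∈ B k ↔ v ∈ A k := by
    rcases hk with ⟨hA, hB⟩ | ⟨hA, hB⟩ <;> simp [hA, hB]
  have forall_two {P : ZMod 2 → Prop} (h₀ : P 0) (h₁ : P 1) : ∀ k, P k :=
    Fin.forall_fin_two.mpr ⟨h₀, h₁⟩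
  by_cases h₀ : Trivial 0
  · rcases slope 0 1 with hs | h₁
    · exact ⟨b 0, c' 1 - c 0, hb 0, forall_two (fun x ↦ trivial_mem h₀ _ _)
        (by simpa using affine 0 1 hs)⟩
    · exact ⟨1, 0, one_ne_zero, forall_two (fun x ↦ trivial_mem h₀ _ _)
        (fun x ↦ trivial_mem (by simpa using h₁) _ _)⟩
  have s₀₀ := (slope 0 0).resolve_right (by simpa using h₀)
  have s₁₁ := (slope 1 1).resolve_right (by simpa using h₀)
  have a₀₀ := affine 0 0 s₀₀
  have a₁₁ := affine 1 1 s₁₁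
  rw [sub_self] at a₀₀ a₁₁
  by_cases h₁ : Trivial 1
  · exact ⟨b 0, c' 0 - c 0, hb 0, forall_two a₀₀ (fun x ↦ trivial_mem h₁ _ _)⟩
  have s₀₁ := (slope 0 1).resolve_right (by simpa using h₁)
  have s₁₀ := (slope 1 0).resolve_right h₁
  have a₀₁ := affine 0 1 s₀₁
  have a₁₀ := affine 1 0 s₁₀
  rw [sub_zero] at a₀₁
  rw [show (0 - 1 : ZMod 2) = 1 from rfl] at a₁₀
  have hb01 : b 1 = b 0 := s₁₀.symm.trans s₀₀
  rw [hb01] at a₁₁ a₁₀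
  have e₀ : c' 0 - c 0 = c' 1 - c 1 := by
    by_contra hne
    exact h₀ (ZMod.eq_empty_or_univ_of_shift_ne (hb 0) hne a₀₀ a₁₁)
  have e₁ : c' 1 - c 0 = c' 0 - c 1 := by
    by_contra hne
    exact h₁ (ZMod.eq_empty_or_univ_of_shift_ne (hb 0) hne a₀₁ a₁₀)
  have two_ne : (2 : ZMod p) ≠ 0 := by
    have hp : p.Prime := Fact.out
    intro h2
    have : p ∣ 2 := (ZMod.natCast_eq_zero_iff 2 p).mp (by exact_mod_cast h2)
    have := (Nat.prime_dvd_prime_iff_eq hp Nat.prime_two).mp this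
    exact absurd hodd (by rw [this]; decide)
  have e : c' 1 = c' 0 := mul_left_cancel₀ two_ne (by linear_combination e₁ - e₀)
  rw [e] at a₀₁
  exact ⟨b 0, c' 0 - c 0, hb 0, forall_two a₀₀ a₀₁⟩

/-- For every odd prime `p`, the cyclic group `ℤ_{2p}` is a BCI-group. -/
theorem Z2p_BCIGroup (p : ℕ) (hp : p.Prime) (hodd : Odd p) :
    IsBCIGroup (Multiplicative (ZMod (2 * p))) := by
  have : Fact p.Prime := ⟨hp⟩
  have : NeZero (2 * p) := ⟨by have := hp.pos; omega⟩
  rintro S T ⟨φ⟩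
  obtain ⟨f, h, hfh⟩ := exists_perm_of_BCay_iso φ
  let e : Multiplicative (ZMod (2 * p)) ≃* Multiplicative (ZMod 2 × ZMod p) :=
    (ZMod.chineseRemainder hodd.coprime_two_left).toAddEquiv.toMultiplicative
  let E : Multiplicative (ZMod (2 * p)) ≃ ZMod 2 × ZMod p :=
    e.toEquiv.trans Multiplicative.toAdd
  have E_symm_sub (u v) : E.symm (u - v) = E.symm u * (E.symm v)⁻¹ :=
    (map_div e.symm (Multiplicative.ofAdd u) (Multiplicative.ofAdd v)).trans (div_eq_mul_inv _ _)
  obtain ⟨g, α, hα⟩ := exists_affine_equiv_of_difference_iso hodd (S := E.symm ⁻¹' S)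
    (T := E.symm ⁻¹' T) (f := E.permCongr f) (h := E.permCongr h) fun x y ↦ by
      simp [E_symm_sub, hfh]
  refine ⟨E.symm g, (e.trans α.toMultiplicative).trans e.symm, ?_⟩
  have key (x) : E.symm g * ((e.trans α.toMultiplicative).trans e.symm) x ∈ T ↔ x ∈ S := by
    have h₁ := hα (E x)
    have h₂ : E.symm (g + α (E x)) =
        E.symm g * ((e.trans α.toMultiplicative).trans e.symm) x :=
      map_mul e.symm (Multiplicative.ofAdd g) (Multiplicative.ofAdd (α (E x)))
    rwa [Set.mem_preimage, Set.mem_preimage, E.symm_apply_apply, h₂] at h₁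
  ext y
  constructor
  · intro hy
    obtain ⟨x, rfl⟩ := (((e.trans α.toMultiplicative).trans e.symm).toEquiv.trans
      (Equiv.mulLeft (E.symm g))).surjective y
    exact ⟨x, (key x).mp hy, rfl⟩
  · rintro ⟨x, hx, rfl⟩
    exact (key x).mpr hx
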